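/- arXiv:2203.03439 — 7 statements merged into one kernel-verified Lean document; each statement's English description precedes it below -/
import Mathlib

section
/- Assume f satisfies conditions (1.3), (1.4) and (1.5). Then Σ_{i=1}^{n} fᵢ(λ)·λᵢ > 0 for every λ ∈ Γ; that is, the Euclidean inner product of the gradient Df(λ) with λ is strictly positive throughout Γ. -/
open Filter

/-- `sup_Γ f`, as an extended real number. -/
noncomputable def gammaSup {n : ℕ} (f : (Fin n → ℝ) → ℝ) (Γ : Set (Fin n → ℝ)) : EReal :=
  ⨆ x ∈ Γ, (f x : EReal)

/-- `sup_{∂Γ} f = sup_{λ₀ ∈ ∂Γ} limsup_{Γ ∋ λ → λ₀} f(λ)`, as an extended real number. -/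
noncomputable def boundarySup {n : ℕ} (f : (Fin n → ℝ) → ℝ) (Γ : Set (Fin n → ℝ)) : EReal :=
  ⨆ x₀ ∈ frontier Γ, Filter.limsup (fun x => (f x : EReal)) (nhdsWithin x₀ Γ)

/-- Lemma A.5: under the structure conditions (1.3) (`Df > 0`), (1.4) (concavity) and
(1.5), one has `Σᵢ fᵢ(λ) λᵢ > 0` for every `λ ∈ Γ`. -/
theorem stmt8 (n : ℕ) (hn : 2 ≤ n) (Γ : Set (Fin n → ℝ))
    (hΓopen : IsOpen Γ) (hΓconv : Convex ℝ Γ)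
    (hΓcone : ∀ x ∈ Γ, ∀ t : ℝ, 0 < t → t • x ∈ Γ)
    (hΓsym : ∀ (σ : Equiv.Perm (Fin n)), ∀ x ∈ Γ, x ∘ σ ∈ Γ)
    (hΓn : {x : Fin n → ℝ | ∀ i, 0 < x i} ⊆ Γ)
    (hΓ1 : Γ ⊆ {x : Fin n → ℝ | 0 < ∑ i, x i})
    (hΓbdry : (frontier Γ).Nonempty)
    (f : (Fin n → ℝ) → ℝ) (Df : (Fin n → ℝ) → Fin n → ℝ)
    (hfsmooth : ContDiffOn ℝ (⊤ : ℕ∞) f Γ)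
    (hfsym : ∀ (σ : Equiv.Perm (Fin n)), ∀ x ∈ Γ, f (x ∘ σ) = f x)
    (hDf : ∀ x ∈ Γ, ∀ i, HasDerivAt (fun s : ℝ => f (x + s • (Pi.single i (1:ℝ) : Fin n → ℝ))) (Df x i) 0)
    (h13 : ∀ x ∈ Γ, ∀ i, 0 < Df x i)
    (h14 : ConcaveOn ℝ Γ f)
    (h15 : ∀ σ : ℝ, (σ : EReal) < gammaSup f Γ →
      ∀ x ∈ Γ, ∃ T : ℝ, ∀ t ≥ T, σ < f (t • x)) :
    ∀ x ∈ Γ, 0 < ∑ i, Df x i * x i := by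
  intro x hx
  have exists_lt : ∃ y ∈ Γ, f x < f y := by
    by_contra! hmax
    let i : Fin n := ⟨0, by omega⟩
    have hcont : Continuous fun s : ℝ => x + s • (Pi.single i (1 : ℝ) : Fin n → ℝ) := by fun_prop
    have hmem : ∀ᶠ s in nhds (0 : ℝ), x + s • (Pi.single i (1 : ℝ) : Fin n → ℝ) ∈ Γ :=
      hcont.continuousAt.eventually_mem (hΓopen.mem_nhds (by simpa using hx))
    have hlocal : IsLocalMax (fun s : ℝ => f (x + s • (Pi.single i (1 : ℝ) : Fin n → ℝ))) 0 := by
      filter_upwards [hmem] with s hs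
      simpa using hmax _ hs
    exact (h13 x hx i).ne' (hlocal.hasDerivAt_eq_zero (hDf x hx i))
  have hsup : (f x : EReal) < gammaSup f Γ := by
    obtain ⟨y, hy, hxy⟩ := exists_lt
    exact (EReal.coe_lt_coe_iff.2 hxy).trans_le (le_iSup₂_of_le y hy le_rfl)
  obtain ⟨T, hT⟩ := h15 _ hsup x hx
  have hdiff : HasFDerivAt f (fderiv ℝ f x) x :=
    ((hfsmooth.contDiffAt (hΓopen.mem_nhds hx)).differentiableAt (by simp)).hasFDerivAt
  have hline (v : Fin n → ℝ) : HasDerivAt (fun s : ℝ => f (x + s • v)) (fderiv ℝ f x v) 0 :=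
    hdiff.hasLineDerivAt v
  have hsum : fderiv ℝ f x x = ∑ i, Df x i * x i := by
    refine (congrArg (fderiv ℝ f x) (pi_eq_sum_univ' x)).trans ?_
    rw [map_sum]
    refine Finset.sum_congr rfl fun i _ => ?_
    rw [map_smul, smul_eq_mul, mul_comm, (hDf x hx i).unique (hline _)]
  have hconc : ConcaveOn ℝ (Set.Ici (0 : ℝ)) fun s : ℝ => f (x + s • x) := by
    have hmem : ∀ s ∈ Set.Ici (0 : ℝ), x + s • x ∈ Γ := fun s hs => by
      have hs' : (0 : ℝ) ≤ s := hs
      simpa [add_smul] using hΓcone x hx (1 + s) (by linarith)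
    refine ⟨convex_Ici 0, fun a ha b hb p q hp hq hpq => ?_⟩
    have h := h14.2 (hmem a ha) (hmem b hb) hp hq hpq
    convert h using 2
    have hp' : p = 1 - q := by linarith
    subst hp'
    module
  set t := max T 2
  have ht : 1 < t := lt_of_lt_of_le one_lt_two (le_max_right _ _)
  have hslope := hconc.slope_le_of_hasDerivAt (x := 0) (y := t - 1) (by simp)
    (Set.mem_Ici.2 (by linarith)) (by linarith) (hline x)
  rw [← hsum]
  refine lt_of_lt_of_le ?_ hslope
  have hxt : x + (t - 1) • x = t • x := by module
  rw [slope_def_field]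
  simp only [zero_smul, add_zero, hxt, sub_zero]
  exact div_pos (sub_pos.2 (hT t (le_max_left _ _))) (by linarith)
end

section
/- Assume f satisfies conditions (1.3), (1.4) and (1.5). Let σ be a real number with sup_{∂Γ} f < σ < sup_Γ f and let t > 0. Then for every λ in the level set ∂Γ^σ, Σ_{i=1}^{n} fᵢ(λ) > (f(t·1⃗) − σ)/t. -/
open Filter

/-- A concave function lies below its tangent hyperplane at a point of differentiability. -/
theorem ConcaveOn.le_add_of_hasFDerivAt {E : Type*} [NormedAddCommGroup E] [NormedSpace ℝ E]
    {s : Set E} {f : E → ℝ} {f' : E →L[ℝ] ℝ} {x y : E} (hf : ConcaveOn ℝ s f)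
    (hx : x ∈ s) (hy : y ∈ s) (hf' : HasFDerivAt f f' x) : f y ≤ f x + f' (y - x) := by
  have hconc := hf.comp_affineMap (AffineMap.lineMap x y : ℝ →ᵃ[ℝ] E)
  have hderiv : HasDerivAt (f ∘ (AffineMap.lineMap x y : ℝ →ᵃ[ℝ] E)) (f' (y - x)) 0 :=
    HasFDerivAt.comp_hasDerivAt 0 (by simpa using hf') AffineMap.hasDerivAt_lineMap
  have hslope := hconc.slope_le_of_hasDerivAt (x := 0) (y := 1) (by simpa using hx)
    (by simpa using hy) one_pos hderiv
  simp only [slope_def_field, Function.comp_apply, AffineMap.lineMap_apply_one,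
    AffineMap.lineMap_apply_zero, sub_zero, div_one] at hslope
  linarith

/-- The value of a Fréchet derivative on `Fin n → ℝ` in terms of the partial derivatives. -/
theorem HasFDerivAt.apply_eq_sum_of_hasDerivAt_single {n : ℕ} {f : (Fin n → ℝ) → ℝ}
    {f' : (Fin n → ℝ) →L[ℝ] ℝ} {x d : Fin n → ℝ} (hf : HasFDerivAt f f' x)
    (hd : ∀ i, HasDerivAt (fun s : ℝ => f (x + s • (Pi.single i (1 : ℝ) : Fin n → ℝ))) (d i) 0)
    (v : Fin n → ℝ) : f' v = ∑ i, v i * d i := by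
  have hpartial (i : Fin n) : f' (Pi.single i 1) = d i :=
    (hf.hasLineDerivAt (Pi.single i 1)).unique (hd i)
  conv_lhs => rw [pi_eq_sum_univ' v]
  simp [map_sum, hpartial]

/-- Lemma 2.1 (first part): for `sup_{∂Γ} f < σ < sup_Γ f` and `t > 0`, every `λ` in the
level set `∂Γ^σ = {λ ∈ Γ : f(λ) = σ}` satisfies `Σᵢ fᵢ(λ) > (f(t·1⃗) - σ)/t`. -/
theorem stmt9 (n : ℕ) (hn : 2 ≤ n) (Γ : Set (Fin n → ℝ))
    (hΓopen : IsOpen Γ) (hΓconv : Convex ℝ Γ)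
    (hΓcone : ∀ x ∈ Γ, ∀ t : ℝ, 0 < t → t • x ∈ Γ)
    (hΓsym : ∀ (σ : Equiv.Perm (Fin n)), ∀ x ∈ Γ, x ∘ σ ∈ Γ)
    (hΓn : {x : Fin n → ℝ | ∀ i, 0 < x i} ⊆ Γ)
    (hΓ1 : Γ ⊆ {x : Fin n → ℝ | 0 < ∑ i, x i})
    (hΓbdry : (frontier Γ).Nonempty)
    (f : (Fin n → ℝ) → ℝ) (Df : (Fin n → ℝ) → Fin n → ℝ)
    (hfsmooth : ContDiffOn ℝ (⊤ : ℕ∞) f Γ)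
    (hfsym : ∀ (σ : Equiv.Perm (Fin n)), ∀ x ∈ Γ, f (x ∘ σ) = f x)
    (hDf : ∀ x ∈ Γ, ∀ i, HasDerivAt (fun s : ℝ => f (x + s • (Pi.single i (1:ℝ) : Fin n → ℝ))) (Df x i) 0)
    (h13 : ∀ x ∈ Γ, ∀ i, 0 < Df x i)
    (h14 : ConcaveOn ℝ Γ f)
    (h15 : ∀ σ : ℝ, (σ : EReal) < gammaSup f Γ →
      ∀ x ∈ Γ, ∃ T : ℝ, ∀ t ≥ T, σ < f (t • x))
    (σ : ℝ) (hσ1 : boundarySup f Γ < (σ : EReal)) (hσ2 : (σ : EReal) < gammaSup f Γ)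
    (t : ℝ) (ht : 0 < t) :
    ∀ x ∈ Γ, f x = σ →
      (f (t • (fun _ => 1 : Fin n → ℝ)) - σ) / t < ∑ i, Df x i := by
  intro x hx hfx
  have hfderiv : HasFDerivAt f (fderiv ℝ f x) x :=
    ((hfsmooth.contDiffAt (hΓopen.mem_nhds hx)).differentiableAt (by simp)).hasFDerivAt
  have hsum := hfderiv.apply_eq_sum_of_hasDerivAt_single (hDf x hx)
  have hradial : 0 < fderiv ℝ f x x := by
    obtain ⟨T, hT⟩ := h15 σ hσ2 x hx
    set s := max T 2
    have hs : 1 < s := one_lt_two.trans_le (le_max_right T 2)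
    have hlt := hT s (le_max_left T 2)
    have hle := h14.le_add_of_hasFDerivAt hx (hΓcone x hx s (by linarith)) hfderiv
    rw [map_sub, map_smul, smul_eq_mul] at hle
    nlinarith
  have hle := h14.le_add_of_hasFDerivAt hx (hΓn fun i => by simpa using ht :
    t • (fun _ => 1 : Fin n → ℝ) ∈ Γ) hfderiv
  rw [map_sub, map_smul, smul_eq_mul, hsum fun _ => 1] at hle
  simp only [one_mul] at hle
  rw [div_lt_iff₀ ht]
  linarith
end

section
/- Assume f satisfies conditions (1.3), (1.4) and (1.5). Let Ψ be a real number with sup_{∂Γ} f < Ψ < sup_Γ f, and let c₀ > 0 be a constant with f(c₀·1⃗) = Ψ. Then for every λ ∈ Γ with f(λ) ≤ Ψ, one has Σ_{i=1}^{n} fᵢ(λ) ≥ (f((1 + c₀)·1⃗) − Ψ)/(1 + c₀), a positive constant independent of λ. -/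
open Filter

/-- A function continuously differentiable at `x` whose partial derivatives there are `g` has
derivative `v ↦ ∑ i, v i * g i`. -/
theorem DifferentiableAt.fderiv_apply_eq_sum {n : ℕ} {f : (Fin n → ℝ) → ℝ} {x g : Fin n → ℝ}
    (hf : DifferentiableAt ℝ f x)
    (hg : ∀ i, HasDerivAt (fun s : ℝ => f (x + s • (Pi.single i (1 : ℝ) : Fin n → ℝ))) (g i) 0)
    (v : Fin n → ℝ) : fderiv ℝ f x v = ∑ i, v i * g i := by
  have hsingle (i : Fin n) : fderiv ℝ f x (Pi.single i 1) = g i :=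
    (hf.hasFDerivAt.hasLineDerivAt (Pi.single i 1)).unique (hg i)
  conv_lhs => rw [pi_eq_sum_univ' v]
  simp [hsingle]

/-- Lemma 2.1 (second part): for `sup_{∂Γ} f < Ψ < sup_Γ f` and `c₀ > 0` with `f(c₀·1⃗) = Ψ`,
every `λ ∈ Γ` with `f(λ) ≤ Ψ` satisfies `Σᵢ fᵢ(λ) ≥ κ := (f((1+c₀)·1⃗) - Ψ)/(1+c₀)`,
a positive constant independent of `λ`. -/
theorem stmt10 (n : ℕ) (hn : 2 ≤ n) (Γ : Set (Fin n → ℝ))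
    (hΓopen : IsOpen Γ) (hΓconv : Convex ℝ Γ)
    (hΓcone : ∀ x ∈ Γ, ∀ t : ℝ, 0 < t → t • x ∈ Γ)
    (hΓsym : ∀ (σ : Equiv.Perm (Fin n)), ∀ x ∈ Γ, x ∘ σ ∈ Γ)
    (hΓn : {x : Fin n → ℝ | ∀ i, 0 < x i} ⊆ Γ)
    (hΓ1 : Γ ⊆ {x : Fin n → ℝ | 0 < ∑ i, x i})
    (hΓbdry : (frontier Γ).Nonempty)
    (f : (Fin n → ℝ) → ℝ) (Df : (Fin n → ℝ) → Fin n → ℝ)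
    (hfsmooth : ContDiffOn ℝ (⊤ : ℕ∞) f Γ)
    (hfsym : ∀ (σ : Equiv.Perm (Fin n)), ∀ x ∈ Γ, f (x ∘ σ) = f x)
    (hDf : ∀ x ∈ Γ, ∀ i, HasDerivAt (fun s : ℝ => f (x + s • (Pi.single i (1:ℝ) : Fin n → ℝ))) (Df x i) 0)
    (h13 : ∀ x ∈ Γ, ∀ i, 0 < Df x i)
    (h14 : ConcaveOn ℝ Γ f)
    (h15 : ∀ σ : ℝ, (σ : EReal) < gammaSup f Γ →
      ∀ x ∈ Γ, ∃ T : ℝ, ∀ t ≥ T, σ < f (t • x))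
    (Ψ : ℝ) (hΨ1 : boundarySup f Γ < (Ψ : EReal)) (hΨ2 : (Ψ : EReal) < gammaSup f Γ)
    (c₀ : ℝ) (hc₀ : 0 < c₀) (hc₀Ψ : f (c₀ • (fun _ => 1 : Fin n → ℝ)) = Ψ) :
    0 < (f ((1 + c₀) • (fun _ => 1 : Fin n → ℝ)) - Ψ) / (1 + c₀) ∧
    ∀ x ∈ Γ, f x ≤ Ψ →
      (f ((1 + c₀) • (fun _ => 1 : Fin n → ℝ)) - Ψ) / (1 + c₀) ≤ ∑ i, Df x i := by
  have hgrad {x y : Fin n → ℝ} (hx : x ∈ Γ) (hy : y ∈ Γ) :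
      f y ≤ f x + ∑ i, (y i - x i) * Df x i := by
    have hd : DifferentiableAt ℝ f x :=
      (hfsmooth.contDiffAt (hΓopen.mem_nhds hx)).differentiableAt (by simp)
    simpa [hd.fderiv_apply_eq_sum (hDf x hx)] using
      h14.le_add_of_hasFDerivAt hx hy hd.hasFDerivAt
  have hones {c : ℝ} (hc : 0 < c) : (c • (fun _ => 1 : Fin n → ℝ)) ∈ Γ :=
    hΓn fun i => by simpa using hc
  have hc₁ : 0 < 1 + c₀ := by linarith
  constructor
  · have hle := hgrad (hones hc₁) (hones hc₀)
    have : NeZero n := ⟨by omega⟩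
    have hsum : 0 < ∑ i, Df ((1 + c₀) • (fun _ => 1 : Fin n → ℝ)) i :=
      Finset.sum_pos (fun i _ => h13 _ (hones hc₁) i) Finset.univ_nonempty
    refine div_pos ?_ hc₁
    simp [hc₀Ψ] at hle hsum
    linarith
  · intro x hx hxΨ
    have hradial : 0 ≤ ∑ i, x i * Df x i := by
      by_contra! hneg
      obtain ⟨T, hT⟩ := h15 Ψ hΨ2 x hx
      have hgt := hT (max T 1) (le_max_left _ _)
      have hle := hgrad hx (hΓcone x hx (max T 1) (by positivity))
      have hsum : ∑ i, ((max T 1 • x) i - x i) * Df x i =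
          (max T 1 - 1) * ∑ i, x i * Df x i := by
        rw [Finset.mul_sum]
        exact Finset.sum_congr rfl fun i _ => by simp only [Pi.smul_apply, smul_eq_mul]; ring
      rw [hsum] at hle
      have := mul_nonpos_of_nonneg_of_nonpos (sub_nonneg.2 (le_max_right T 1)) hneg.le
      linarith
    have hle := hgrad hx (hones hc₁)
    simp [sub_mul, Finset.sum_sub_distrib, ← Finset.mul_sum] at hle
    rw [div_le_iff₀ hc₁]
    simp
    linarith
end

section
/- Assume f satisfies conditions (1.3) and (1.4). Let σ be a real number with sup_{∂Γ} f < σ < sup_Γ f, assume there is a constant c_σ > 0 with f(c_σ·1⃗) = σ, and assume the level set ∂Γ^σ is connected. If there exists λ'' ∈ ∂Γ^σ with ⟨Df(λ''), λ''⟩ < 0, then there exists λ' ∈ ∂Γ^σ with ⟨Df(λ'), λ'⟩ = 0; equivalently, the origin lies in the tangent hyperplane {μ ∈ ℝⁿ : ⟨Df(λ'), μ − λ'⟩ = 0} to the level surface ∂Γ^σ at λ'. -/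
open Filter

/-- Where the partial derivatives of a differentiable function are known, they determine the
derivative in every direction. -/
theorem fderiv_apply_eq_sum_of_hasDerivAt {n : ℕ} {f : (Fin n → ℝ) → ℝ} {x g : Fin n → ℝ}
    (hf : DifferentiableAt ℝ f x)
    (hg : ∀ i, HasDerivAt (fun s : ℝ => f (x + s • (Pi.single i (1 : ℝ) : Fin n → ℝ))) (g i) 0)
    (v : Fin n → ℝ) : fderiv ℝ f x v = ∑ i, g i * v i := by
  have hpartial : ∀ i, fderiv ℝ f x (Pi.single i 1) = g i := fun i =>
    (hf.hasFDerivAt.hasLineDerivAt (Pi.single i 1)).unique (hg i)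
  conv_lhs => rw [pi_eq_sum_univ' v]
  simp only [map_sum, map_smul, smul_eq_mul]
  refine Finset.sum_congr rfl fun i _ => ?_
  rw [← hpartial i, mul_comm]

/-- Proposition A.2: assume (1.3) and (1.4).  For `sup_{∂Γ} f < σ < sup_Γ f` with
`f(c_σ·1⃗) = σ` for some `c_σ > 0` and connected level set `∂Γ^σ`, if some
`λ'' ∈ ∂Γ^σ` has `⟨Df(λ''), λ''⟩ < 0`, then some `λ' ∈ ∂Γ^σ` has `⟨Df(λ'), λ'⟩ = 0`;
equivalently, the origin lies in the tangent hyperplane to `∂Γ^σ` at `λ'`. -/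
theorem stmt11 (n : ℕ) (hn : 2 ≤ n) (Γ : Set (Fin n → ℝ))
    (hΓopen : IsOpen Γ) (hΓconv : Convex ℝ Γ)
    (hΓcone : ∀ x ∈ Γ, ∀ t : ℝ, 0 < t → t • x ∈ Γ)
    (hΓsym : ∀ (σ : Equiv.Perm (Fin n)), ∀ x ∈ Γ, x ∘ σ ∈ Γ)
    (hΓn : {x : Fin n → ℝ | ∀ i, 0 < x i} ⊆ Γ)
    (hΓ1 : Γ ⊆ {x : Fin n → ℝ | 0 < ∑ i, x i})
    (hΓbdry : (frontier Γ).Nonempty)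
    (f : (Fin n → ℝ) → ℝ) (Df : (Fin n → ℝ) → Fin n → ℝ)
    (hfsmooth : ContDiffOn ℝ (⊤ : ℕ∞) f Γ)
    (hfsym : ∀ (σ : Equiv.Perm (Fin n)), ∀ x ∈ Γ, f (x ∘ σ) = f x)
    (hDf : ∀ x ∈ Γ, ∀ i, HasDerivAt (fun s : ℝ => f (x + s • (Pi.single i (1:ℝ) : Fin n → ℝ))) (Df x i) 0)
    (h13 : ∀ x ∈ Γ, ∀ i, 0 < Df x i)
    (h14 : ConcaveOn ℝ Γ f)
    (σ : ℝ) (hσ1 : boundarySup f Γ < (σ : EReal)) (hσ2 : (σ : EReal) < gammaSup f Γ)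
    (cσ : ℝ) (hcσ : 0 < cσ) (hcσf : f (cσ • (fun _ => 1 : Fin n → ℝ)) = σ)
    (hconn : IsConnected {x : Fin n → ℝ | x ∈ Γ ∧ f x = σ})
    (lam'' : Fin n → ℝ) (hlam''Γ : lam'' ∈ Γ) (hlam''σ : f lam'' = σ)
    (hneg : ∑ i, Df lam'' i * lam'' i < 0) :
    ∃ lam' : Fin n → ℝ, lam' ∈ Γ ∧ f lam' = σ ∧
      (∑ i, Df lam' i * lam' i = 0) ∧
      (0 : Fin n → ℝ) ∈ {μ : Fin n → ℝ | ∑ i, Df lam' i * (μ i - lam' i) = 0} := by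
  have hdiff : ∀ x ∈ Γ, fderiv ℝ f x x = ∑ i, Df x i * x i := fun x hx =>
    fderiv_apply_eq_sum_of_hasDerivAt
      ((hfsmooth.contDiffAt (hΓopen.mem_nhds hx)).differentiableAt (by simp)) (hDf x hx) x
  have hcont : ContinuousOn (fun x => fderiv ℝ f x x) {x | x ∈ Γ ∧ f x = σ} :=
    ((hfsmooth.continuousOn_fderiv_of_isOpen hΓopen (by simp)).clm_apply continuousOn_id).mono
      fun _ hx => hx.1
  have hdiag : cσ • (fun _ => 1 : Fin n → ℝ) ∈ Γ := hΓn fun i => by simpa using hcσ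
  have hpos : 0 ≤ ∑ i, Df (cσ • (fun _ => 1)) i * (cσ • (fun _ => 1 : Fin n → ℝ)) i :=
    Finset.sum_nonneg fun i _ => mul_nonneg (h13 _ hdiag i).le (by simpa using hcσ.le)
  obtain ⟨x, ⟨hxΓ, hxσ⟩, hx⟩ := hconn.isPreconnected.intermediate_value
    (show lam'' ∈ _ from ⟨hlam''Γ, hlam''σ⟩) ⟨hdiag, hcσf⟩ hcont
    (show (0 : ℝ) ∈ _ from ⟨(hdiff _ hlam''Γ).trans_le hneg.le, hpos.trans_eq (hdiff _ hdiag).symm⟩)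
  have hzero : ∑ i, Df x i * x i = 0 := (hdiff x hxΓ).symm.trans hx
  exact ⟨x, hxΓ, hxσ, hzero, by simp [hzero]⟩
end

section
/- Assume f satisfies conditions (1.3) and (1.4). Let σ be a real number with sup_{∂Γ} f < σ < sup_Γ f, assume there is a constant c_σ > 0 with f(c_σ·1⃗) = σ, and assume the level set ∂Γ^σ is connected. If there exists λ ∈ ∂Γ^σ with Σ_{i=1}^{n} fᵢ(λ)·λᵢ ≤ 0, then there exists μ ∈ Γ such that f(tμ) < σ for every t > 0; geometrically, the ray {tμ : t > 0} does not intersect ∂Γ^σ. -/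
/-- A concave function lies below its tangent hyperplanes. -/
theorem ConcaveOn.le_add_fderiv {E : Type*} [NormedAddCommGroup E] [NormedSpace ℝ E]
    {s : Set E} {f : E → ℝ} (hf : ConcaveOn ℝ s f) {x y : E} (hx : x ∈ s) (hy : y ∈ s)
    (hd : DifferentiableAt ℝ f x) : f y ≤ f x + fderiv ℝ f x (y - x) := by
  have hline : HasDerivAt (fun r : ℝ => f (AffineMap.lineMap x y r)) (fderiv ℝ f x (y - x)) 0 := by
    refine HasFDerivAt.comp_hasDerivAt (0 : ℝ) ?_ AffineMap.hasDerivAt_lineMap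
    simpa using hd.hasFDerivAt
  have hconc := hf.comp_affineMap (AffineMap.lineMap (k := ℝ) x y)
  have hslope := hconc.slope_le_of_hasDerivAt (x := 0) (y := 1) (by simpa using hx)
    (by simpa using hy) one_pos hline
  simp only [slope_def_field, Function.comp_apply, AffineMap.lineMap_apply_one,
    AffineMap.lineMap_apply_zero, sub_zero, div_one] at hslope
  linarith


open Filter

/-- Corollary A.3: assume (1.3) and (1.4).  For `sup_{∂Γ} f < σ < sup_Γ f` with
`f(c_σ·1⃗) = σ` for some `c_σ > 0` and connected level set `∂Γ^σ`, if some `λ ∈ ∂Γ^σ` has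
`Σᵢ fᵢ(λ) λᵢ ≤ 0`, then there is `μ ∈ Γ` with `f(tμ) < σ` for every `t > 0`; geometrically,
the ray `{tμ : t > 0}` does not intersect `∂Γ^σ`. -/
theorem stmt12 (n : ℕ) (hn : 2 ≤ n) (Γ : Set (Fin n → ℝ))
    (hΓopen : IsOpen Γ) (hΓconv : Convex ℝ Γ)
    (hΓcone : ∀ x ∈ Γ, ∀ t : ℝ, 0 < t → t • x ∈ Γ)
    (hΓsym : ∀ (σ : Equiv.Perm (Fin n)), ∀ x ∈ Γ, x ∘ σ ∈ Γ)
    (hΓn : {x : Fin n → ℝ | ∀ i, 0 < x i} ⊆ Γ)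
    (hΓ1 : Γ ⊆ {x : Fin n → ℝ | 0 < ∑ i, x i})
    (hΓbdry : (frontier Γ).Nonempty)
    (f : (Fin n → ℝ) → ℝ) (Df : (Fin n → ℝ) → Fin n → ℝ)
    (hfsmooth : ContDiffOn ℝ (⊤ : ℕ∞) f Γ)
    (hfsym : ∀ (σ : Equiv.Perm (Fin n)), ∀ x ∈ Γ, f (x ∘ σ) = f x)
    (hDf : ∀ x ∈ Γ, ∀ i, HasDerivAt (fun s : ℝ => f (x + s • (Pi.single i (1:ℝ) : Fin n → ℝ))) (Df x i) 0)
    (h13 : ∀ x ∈ Γ, ∀ i, 0 < Df x i)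
    (h14 : ConcaveOn ℝ Γ f)
    (σ : ℝ) (hσ1 : boundarySup f Γ < (σ : EReal)) (hσ2 : (σ : EReal) < gammaSup f Γ)
    (cσ : ℝ) (hcσ : 0 < cσ) (hcσf : f (cσ • (fun _ => 1 : Fin n → ℝ)) = σ)
    (hconn : IsConnected {x : Fin n → ℝ | x ∈ Γ ∧ f x = σ})
    (lam : Fin n → ℝ) (hlamΓ : lam ∈ Γ) (hlamσ : f lam = σ)
    (hnonpos : ∑ i, Df lam i * lam i ≤ 0) :
    ∃ μ ∈ Γ, ∀ t : ℝ, 0 < t → f (t • μ) < σ := by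
  have hdiff : ∀ x ∈ Γ, DifferentiableAt ℝ f x := fun x hx =>
    (hfsmooth.contDiffAt (hΓopen.mem_nhds hx)).differentiableAt (by simp)
  have hfderiv : ∀ x ∈ Γ, ∀ v : Fin n → ℝ, fderiv ℝ f x v = ∑ i, Df x i * v i := by
    intro x hx v
    have hpartial : ∀ i, fderiv ℝ f x (Pi.single i (1 : ℝ)) = Df x i := fun i =>
      ((hdiff x hx).hasFDerivAt.hasLineDerivAt (Pi.single i (1 : ℝ))).unique (hDf x hx i)
    conv_lhs => rw [pi_eq_sum_univ' v]
    simp [hpartial, mul_comm]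
  have hcont : ContinuousOn (fun x => fderiv ℝ f x x) {x : Fin n → ℝ | x ∈ Γ ∧ f x = σ} :=
    ((hfsmooth.continuousOn_fderiv_of_isOpen hΓopen (by simp)).clm_apply continuousOn_id).mono
      fun x hx => hx.1
  have hcΓ : cσ • (fun _ => 1 : Fin n → ℝ) ∈ Γ := hΓn fun i => by simpa using hcσ
  have hcpos : 0 ≤ fderiv ℝ f (cσ • (fun _ => 1 : Fin n → ℝ)) (cσ • (fun _ => 1 : Fin n → ℝ)) := by
    rw [hfderiv _ hcΓ]
    exact Finset.sum_nonneg fun i _ => mul_nonneg (h13 _ hcΓ i).le (by simpa using hcσ.le)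
  obtain ⟨ξ, ⟨hξΓ, hξσ⟩, hξ⟩ := hconn.isPreconnected.intermediate_value
    (show lam ∈ _ from ⟨hlamΓ, hlamσ⟩) (show cσ • (fun _ => 1 : Fin n → ℝ) ∈ _ from ⟨hcΓ, hcσf⟩)
    hcont (show (0 : ℝ) ∈ Set.Icc _ _ from ⟨by rwa [hfderiv _ hlamΓ], hcpos⟩)
  obtain ⟨ε, hεΓ, hε⟩ : ∃ ε : ℝ, ξ - ε • (fun _ => 1 : Fin n → ℝ) ∈ Γ ∧ 0 < ε := by
    have htend : Tendsto (fun ε : ℝ => ξ - ε • (fun _ => 1 : Fin n → ℝ)) (nhdsWithin 0 (Set.Ioi 0))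
        (nhds ξ) := by
      refine (Continuous.tendsto' ?_ 0 ξ (by simp)).mono_left nhdsWithin_le_nhds
      fun_prop
    exact ((htend.eventually (hΓopen.mem_nhds hξΓ)).and self_mem_nhdsWithin).exists
  refine ⟨_, hεΓ, fun t ht => ?_⟩
  have htξ := hΓcone ξ hξΓ t ht
  have hray : f (t • ξ) ≤ σ := by
    have h := h14.le_add_fderiv hξΓ htξ (hdiff ξ hξΓ)
    simp only [map_sub, map_smul] at h
    simpa [hξ, hξσ] using h
  have hstep := h14.le_add_fderiv htξ (hΓcone _ hεΓ t ht) (hdiff _ htξ)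
  have hneg : fderiv ℝ f (t • ξ) (t • (ξ - ε • (fun _ => 1 : Fin n → ℝ)) - t • ξ) < 0 := by
    rw [hfderiv _ htξ]
    refine Finset.sum_neg (fun i _ => ?_) ⟨⟨0, by omega⟩, Finset.mem_univ _⟩
    refine mul_neg_of_pos_of_neg (h13 _ htξ i) ?_
    simp only [Pi.sub_apply, Pi.smul_apply, smul_eq_mul]
    nlinarith [mul_pos ht hε]
  linarith
end

section
/- Assume f satisfies conditions (1.3) and (1.4), that sup_{∂Γ} f < sup_Γ f, and that for every σ ∈ (sup_{∂Γ} f, sup_Γ f) the level set ∂Γ^σ is connected and contains a diagonal point c_σ·1⃗ for some c_σ > 0. For λ ∈ Γ write l_λ = {tλ : t > 0}. Then the following three statements are equivalent: (1) condition (1.5) holds; (2) for every σ ∈ (sup_{∂Γ} f, sup_Γ f) and every λ ∈ Γ, the ray l_λ intersects ∂Γ^σ; (3) for every σ ∈ (sup_{∂Γ} f, sup_Γ f) and every λ ∈ Γ, the ray l_λ intersects ∂Γ^σ in exactly one point. -/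
open Filter

/-- A function with positive partial derivatives on an open set does not attain its supremum. -/
theorem coe_lt_gammaSup {n : ℕ} {Γ : Set (Fin n → ℝ)} (hΓ : IsOpen Γ) {f : (Fin n → ℝ) → ℝ}
    {y : Fin n → ℝ} (hy : y ∈ Γ) {i : Fin n} {d : ℝ} (hd : 0 < d)
    (hf : HasDerivAt (fun s : ℝ => f (y + s • (Pi.single i (1 : ℝ) : Fin n → ℝ))) d 0) :
    (f y : EReal) < gammaSup f Γ := by
  by_contra! h
  have hle : ∀ z ∈ Γ, f z ≤ f y := fun z hz =>
    EReal.coe_le_coe_iff.1 ((le_iSup₂ (f := fun x (_ : x ∈ Γ) => (f x : EReal)) z hz).trans h)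
  have hcont : ContinuousAt (fun s : ℝ => y + s • (Pi.single i (1 : ℝ) : Fin n → ℝ)) 0 := by
    fun_prop
  have hmem : ∀ᶠ s : ℝ in nhds 0, y + s • (Pi.single i (1 : ℝ) : Fin n → ℝ) ∈ Γ :=
    hcont.eventually (hΓ.mem_nhds (by simpa using hy))
  have hmax : IsLocalMax (fun s : ℝ => f (y + s • (Pi.single i (1 : ℝ) : Fin n → ℝ))) 0 := by
    filter_upwards [hmem] with s hs
    simpa using hle _ hs
  exact hd.ne' (hmax.hasDerivAt_eq_zero hf)

/-- Rays in a cone not containing the origin tend to the origin within the cone. -/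
theorem tendsto_smul_nhdsWithin_zero {E : Type*} [AddCommGroup E] [Module ℝ E]
    [TopologicalSpace E] [ContinuousSMul ℝ E] {Γ : Set E}
    (hcone : ∀ x ∈ Γ, ∀ t : ℝ, 0 < t → t • x ∈ Γ) {x : E} (hx : x ∈ Γ) :
    Tendsto (fun t : ℝ => t • x) (nhdsWithin 0 (Set.Ioi 0)) (nhdsWithin 0 Γ) := by
  refine tendsto_nhdsWithin_iff.2 ⟨?_, ?_⟩
  · have h : ContinuousAt (fun t : ℝ => t • x) 0 := by fun_prop
    simpa [ContinuousAt] using h.tendsto.mono_left nhdsWithin_le_nhds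
  · filter_upwards [self_mem_nhdsWithin] with t ht
    exact hcone x hx t ht

/-- Near the origin, along any ray of the cone, `f` stays below each level above its
boundary supremum. -/
theorem eventually_smul_lt_of_boundarySup_lt {n : ℕ} {Γ : Set (Fin n → ℝ)} (hΓ : IsOpen Γ)
    (hcone : ∀ x ∈ Γ, ∀ t : ℝ, 0 < t → t • x ∈ Γ) (h0 : (0 : Fin n → ℝ) ∉ Γ)
    {f : (Fin n → ℝ) → ℝ} {σ : ℝ} (hσ : boundarySup f Γ < σ) {x : Fin n → ℝ} (hx : x ∈ Γ) :
    ∀ᶠ t : ℝ in nhdsWithin 0 (Set.Ioi 0), f (t • x) < σ := by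
  have ht := tendsto_smul_nhdsWithin_zero hcone hx
  have hmem : (0 : Fin n → ℝ) ∈ frontier Γ := by
    rw [hΓ.frontier_eq]
    exact ⟨mem_closure_iff_nhdsWithin_neBot.2 ht.neBot, h0⟩
  have hlt : limsup (fun x => (f x : EReal)) (nhdsWithin 0 Γ) < σ :=
    (le_iSup₂ (f := fun x₀ (_ : x₀ ∈ frontier Γ) =>
      limsup (fun x => (f x : EReal)) (nhdsWithin x₀ Γ)) 0 hmem).trans_lt hσ
  filter_upwards [ht.eventually (eventually_lt_of_limsup_lt hlt)] with t h
  exact EReal.coe_lt_coe_iff.1 h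

/-- A continuous concave function on the positive half-line that is small near zero and exceeds
its maximum on every compact interval is strictly increasing. -/
theorem ConcaveOn.strictMonoOn_Ioi_of_exceeds_compact_maxima {g : ℝ → ℝ}
    (hg : ConcaveOn ℝ (Set.Ioi 0) g) (hcont : ContinuousOn g (Set.Ioi 0)) {m : ℝ}
    (hzero : ∀ᶠ t in nhdsWithin 0 (Set.Ioi 0), g t < m)
    (hlarge : ∀ u > 0, ∃ t > 0, max m (g u) < g t) :
    StrictMonoOn g (Set.Ioi 0) := by
  intro s hs t ht hst
  by_contra! hts
  obtain ⟨δ, hδ, hsmall⟩ := mem_nhdsGT_iff_exists_Ioc_subset.1 hzero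
  have hδ0 : 0 < min δ s := lt_min hδ hs
  obtain ⟨u, hu, hmax⟩ := (isCompact_Icc (a := min δ s) (b := t)).exists_isMaxOn
    ⟨t, (min_le_right _ _).trans hst.le, le_rfl⟩
    (hcont.mono fun v hv => hδ0.trans_le hv.1)
  obtain ⟨r, hr, hru⟩ := hlarge u (hδ0.trans_le hu.1)
  have hmr := (le_max_left _ _).trans_lt hru
  have hur := (le_max_right _ _).trans_lt hru
  rcases lt_or_ge r (min δ s) with h | h
  · exact lt_asymm hmr (hsmall ⟨hr, h.le.trans (min_le_left _ _)⟩)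
  rcases le_or_gt r t with h' | h'
  · exact (hmax ⟨h, h'⟩).not_gt hur
  have htr : g t < g r := (hmax ⟨(min_le_right _ _).trans hst.le, le_rfl⟩ : g t ≤ g u).trans_lt hur
  have hslope := hg.slope_anti_adjacent hs hr hst h'
  have hpos : 0 < (g r - g t) / (r - t) := div_pos (sub_pos.2 htr) (sub_pos.2 h')
  have hneg : (g t - g s) / (t - s) ≤ 0 :=
    div_nonpos_of_nonpos_of_nonneg (sub_nonpos.2 hts) (sub_pos.2 hst).le
  linarith

/-- Proposition A.1: assume (1.3), (1.4), `sup_{∂Γ} f < sup_Γ f`, and that for each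
`σ ∈ (sup_{∂Γ} f, sup_Γ f)` the level set `∂Γ^σ` is connected and contains a diagonal point
`c_σ·1⃗` with `c_σ > 0`.  Then the following are equivalent: (1) condition (1.5) holds;
(2) for every such `σ` and every `λ ∈ Γ` the ray `l_λ = {tλ : t > 0}` intersects `∂Γ^σ`;
(3) for every such `σ` and every `λ ∈ Γ` the ray `l_λ` meets `∂Γ^σ` in exactly one point. -/
theorem stmt13 (n : ℕ) (hn : 2 ≤ n) (Γ : Set (Fin n → ℝ))
    (hΓopen : IsOpen Γ) (hΓconv : Convex ℝ Γ)
    (hΓcone : ∀ x ∈ Γ, ∀ t : ℝ, 0 < t → t • x ∈ Γ)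
    (hΓsym : ∀ (σ : Equiv.Perm (Fin n)), ∀ x ∈ Γ, x ∘ σ ∈ Γ)
    (hΓn : {x : Fin n → ℝ | ∀ i, 0 < x i} ⊆ Γ)
    (hΓ1 : Γ ⊆ {x : Fin n → ℝ | 0 < ∑ i, x i})
    (hΓbdry : (frontier Γ).Nonempty)
    (f : (Fin n → ℝ) → ℝ) (Df : (Fin n → ℝ) → Fin n → ℝ)
    (hfsmooth : ContDiffOn ℝ (⊤ : ℕ∞) f Γ)
    (hfsym : ∀ (σ : Equiv.Perm (Fin n)), ∀ x ∈ Γ, f (x ∘ σ) = f x)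
    (hDf : ∀ x ∈ Γ, ∀ i, HasDerivAt (fun s : ℝ => f (x + s • (Pi.single i (1:ℝ) : Fin n → ℝ))) (Df x i) 0)
    (h13 : ∀ x ∈ Γ, ∀ i, 0 < Df x i)
    (h14 : ConcaveOn ℝ Γ f)
    (hsup : boundarySup f Γ < gammaSup f Γ)
    (hlevel : ∀ σ : ℝ, boundarySup f Γ < (σ : EReal) → (σ : EReal) < gammaSup f Γ →
      IsConnected {x : Fin n → ℝ | x ∈ Γ ∧ f x = σ} ∧
      ∃ c : ℝ, 0 < c ∧ (c • (fun _ => 1 : Fin n → ℝ)) ∈ Γ ∧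
        f (c • (fun _ => 1 : Fin n → ℝ)) = σ) :
    ((∀ σ : ℝ, (σ : EReal) < gammaSup f Γ →
        ∀ x ∈ Γ, ∃ T : ℝ, ∀ t ≥ T, σ < f (t • x)) ↔
      (∀ σ : ℝ, boundarySup f Γ < (σ : EReal) → (σ : EReal) < gammaSup f Γ →
        ∀ x ∈ Γ, ∃ t : ℝ, 0 < t ∧ t • x ∈ Γ ∧ f (t • x) = σ)) ∧
    ((∀ σ : ℝ, boundarySup f Γ < (σ : EReal) → (σ : EReal) < gammaSup f Γ →
        ∀ x ∈ Γ, ∃ t : ℝ, 0 < t ∧ t • x ∈ Γ ∧ f (t • x) = σ) ↔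
      (∀ σ : ℝ, boundarySup f Γ < (σ : EReal) → (σ : EReal) < gammaSup f Γ →
        ∀ x ∈ Γ, ∃! t : ℝ, 0 < t ∧ t • x ∈ Γ ∧ f (t • x) = σ)) := by
  have h0 : (0 : Fin n → ℝ) ∉ Γ := fun h => by simpa using hΓ1 h
  have hcont : ∀ x ∈ Γ, ContinuousOn (fun t : ℝ => f (t • x)) (Set.Ioi 0) := fun x hx =>
    hfsmooth.continuousOn.comp (by fun_prop) fun t ht => hΓcone x hx t ht
  have hconc : ∀ x ∈ Γ, ConcaveOn ℝ (Set.Ioi 0) (fun t : ℝ => f (t • x)) := fun x hx =>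
    (h14.comp_linearMap (LinearMap.toSpanSingleton ℝ _ x)).subset
      (fun t ht => hΓcone x hx t ht) (convex_Ioi 0)
  obtain ⟨m, hbm, hmg⟩ := EReal.lt_iff_exists_real_btwn.1 hsup
  have hmono : (∀ σ : ℝ, boundarySup f Γ < (σ : EReal) → (σ : EReal) < gammaSup f Γ →
      ∀ x ∈ Γ, ∃ t : ℝ, 0 < t ∧ t • x ∈ Γ ∧ f (t • x) = σ) →
      ∀ x ∈ Γ, StrictMonoOn (fun t : ℝ => f (t • x)) (Set.Ioi 0) := by
    intro h x hx
    refine (hconc x hx).strictMonoOn_Ioi_of_exceeds_compact_maxima (hcont x hx)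
      (eventually_smul_lt_of_boundarySup_lt hΓopen hΓcone h0 hbm hx) fun u hu => ?_
    have hux := hΓcone x hx u hu
    have hfu : (f (u • x) : EReal) < gammaSup f Γ :=
      coe_lt_gammaSup hΓopen hux (h13 _ hux ⟨0, by omega⟩) (hDf _ hux _)
    obtain ⟨σ, hσ, hσg⟩ := EReal.lt_iff_exists_real_btwn.1 (max_lt hmg hfu)
    obtain ⟨hmσ, huσ⟩ := max_lt_iff.1 hσ
    obtain ⟨t, ht, -, rfl⟩ := h σ (hbm.trans hmσ) hσg x hx
    exact ⟨t, ht, max_lt (EReal.coe_lt_coe_iff.1 hmσ) (EReal.coe_lt_coe_iff.1 huσ)⟩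
  refine ⟨⟨fun h σ hbσ hσg x hx => ?_, fun h σ hσg x hx => ?_⟩,
    fun h σ hbσ hσg x hx => ?_, fun h σ hbσ hσg x hx => (h σ hbσ hσg x hx).exists⟩
  · obtain ⟨T, hT⟩ := h σ hσg x hx
    obtain ⟨s, hs, hs0⟩ := ((eventually_smul_lt_of_boundarySup_lt hΓopen hΓcone h0 hbσ hx).and
      self_mem_nhdsWithin).exists
    obtain ⟨t, ht, hft⟩ := intermediate_value_Icc (le_max_left s T)
      ((hcont x hx).mono fun v hv => hs0.trans_le hv.1)
      ⟨hs.le, (hT _ (le_max_right s T)).le⟩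
    have ht0 := hs0.trans_le ht.1
    exact ⟨t, ht0, hΓcone x hx t ht0, hft⟩
  · obtain ⟨τ, hτ, hτg⟩ := EReal.lt_iff_exists_real_btwn.1 (max_lt hsup hσg)
    obtain ⟨hbτ, hστ⟩ := max_lt_iff.1 hτ
    obtain ⟨t, ht, -, rfl⟩ := h τ hbτ hτg x hx
    exact ⟨t, fun r hr => (EReal.coe_lt_coe_iff.1 hστ).trans_le
      ((hmono h x hx).monotoneOn ht (ht.trans_le hr) hr)⟩
  · obtain ⟨t, ht, htΓ, hft⟩ := h σ hbσ hσg x hx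
    exact ⟨t, ⟨ht, htΓ, hft⟩, fun r ⟨hr, _, hfr⟩ =>
      (hmono h x hx).injOn hr ht (hfr.trans hft.symm)⟩
end

section
/- Assume f satisfies conditions (1.3), (1.4) and (1.5). Then for every λ ∈ Γ, the function t ↦ f(tλ) is strictly monotone increasing on (0, +∞). In particular, for every real σ, each ray {tλ : t > 0} with λ ∈ Γ meets the level set ∂Γ^σ in at most one point. -/
open Filter

/-- If one partial derivative of `f` is positive at a point `y` of the open set `Γ`, then `f y` is
strictly below the supremum of `f` over `Γ`. -/
theorem coe_lt_gammaSup_of_hasDerivAt_pos {n : ℕ} {f : (Fin n → ℝ) → ℝ} {Γ : Set (Fin n → ℝ)}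
    (hΓ : IsOpen Γ) {y v : Fin n → ℝ} (hy : y ∈ Γ) {c : ℝ} (hc : 0 < c)
    (hf : HasDerivAt (fun s : ℝ => f (y + s • v)) c 0) :
    (f y : EReal) < gammaSup f Γ := by
  by_contra! hle
  have hmax : ∀ z ∈ Γ, f z ≤ f y := fun z hz =>
    EReal.coe_le_coe_iff.1 ((le_iSup₂ (f := fun x (_ : x ∈ Γ) => (f x : EReal)) z hz).trans hle)
  have hcont : Continuous fun s : ℝ => y + s • v := by fun_prop
  have hmem : ∀ᶠ s : ℝ in nhds 0, y + s • v ∈ Γ :=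
    hcont.continuousAt.eventually_mem (hΓ.mem_nhds (by simpa using hy))
  have hloc : IsLocalMax (fun s : ℝ => f (y + s • v)) 0 := by
    filter_upwards [hmem] with s hs
    simpa using hmax _ hs
  exact hc.ne' (hloc.hasDerivAt_eq_zero hf)

/-- Assume (1.3), (1.4) and (1.5).  Then for every `λ ∈ Γ` the function `t ↦ f(tλ)` is
strictly increasing on `(0, ∞)`; in particular each ray `{tλ : t > 0}` meets any level set
`∂Γ^σ` in at most one point. -/
theorem stmt14 (n : ℕ) (hn : 2 ≤ n) (Γ : Set (Fin n → ℝ))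
    (hΓopen : IsOpen Γ) (hΓconv : Convex ℝ Γ)
    (hΓcone : ∀ x ∈ Γ, ∀ t : ℝ, 0 < t → t • x ∈ Γ)
    (hΓsym : ∀ (σ : Equiv.Perm (Fin n)), ∀ x ∈ Γ, x ∘ σ ∈ Γ)
    (hΓn : {x : Fin n → ℝ | ∀ i, 0 < x i} ⊆ Γ)
    (hΓ1 : Γ ⊆ {x : Fin n → ℝ | 0 < ∑ i, x i})
    (hΓbdry : (frontier Γ).Nonempty)
    (f : (Fin n → ℝ) → ℝ) (Df : (Fin n → ℝ) → Fin n → ℝ)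
    (hfsmooth : ContDiffOn ℝ (⊤ : ℕ∞) f Γ)
    (hfsym : ∀ (σ : Equiv.Perm (Fin n)), ∀ x ∈ Γ, f (x ∘ σ) = f x)
    (hDf : ∀ x ∈ Γ, ∀ i, HasDerivAt (fun s : ℝ => f (x + s • (Pi.single i (1:ℝ) : Fin n → ℝ))) (Df x i) 0)
    (h13 : ∀ x ∈ Γ, ∀ i, 0 < Df x i)
    (h14 : ConcaveOn ℝ Γ f)
    (h15 : ∀ σ : ℝ, (σ : EReal) < gammaSup f Γ →
      ∀ x ∈ Γ, ∃ T : ℝ, ∀ t ≥ T, σ < f (t • x)) :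
    (∀ x ∈ Γ, StrictMonoOn (fun t : ℝ => f (t • x)) (Set.Ioi (0 : ℝ))) ∧
    ∀ σ : ℝ, ∀ x ∈ Γ, ∀ s t : ℝ, 0 < s → 0 < t →
      (s • x ∈ Γ ∧ f (s • x) = σ) → (t • x ∈ Γ ∧ f (t • x) = σ) → s = t := by
  have hmono : ∀ x ∈ Γ, StrictMonoOn (fun t : ℝ => f (t • x)) (Set.Ioi (0 : ℝ)) := by
    intro x hx s hs t ht hst
    have hs0 : 0 < s := hs
    have hsx := hΓcone x hx s hs0
    have hlt := coe_lt_gammaSup_of_hasDerivAt_pos hΓopen hsx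
      (h13 _ hsx ⟨0, by lia⟩) (hDf _ hsx ⟨0, by lia⟩)
    obtain ⟨T, hT⟩ := h15 _ hlt x hx
    obtain ⟨u, huT, htu⟩ : ∃ u, T ≤ u ∧ t < u :=
      ⟨max T (t + 1), le_max_left _ _, lt_of_lt_of_le (lt_add_one t) (le_max_right _ _)⟩
    have hfu := hT u huT
    have hux := hΓcone x hx u (hs0.trans (hst.trans htu))
    obtain ⟨a, b, ha, hb, hab, rfl⟩ : t ∈ openSegment ℝ s u := by
      rw [openSegment_eq_Ioo (hst.trans htu)]
      exact ⟨hst, htu⟩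
    have hconc := h14.2 hsx hux ha.le hb.le hab
    have hcomb : a • s • x + b • u • x = (a • s + b • u) • x := by
      simp only [add_smul, smul_assoc]
    rw [hcomb, smul_eq_mul, smul_eq_mul] at hconc
    refine lt_of_lt_of_le ?_ hconc
    have hb' : 0 < b * (f (u • x) - f (s • x)) := mul_pos hb (sub_pos.2 hfu)
    obtain rfl : a = 1 - b := by linarith
    linarith
  exact ⟨hmono, fun σ x hx s t hs ht h₁ h₂ => (hmono x hx).injOn hs ht (h₁.2.trans h₂.2.symm)⟩
end
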